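/- Let a₁, a₂ ∈ ℂ with a₁ − a₂ ∉ Λ_τ and a₁, a₂ ∉ S, let A ∈ ℂ, and assume c = ζ(a₁) + ζ(a₂). With φ_{a,c}(z) = c + ζ(z−a₁) + ζ(z−a₂) − ζ(z) − (1/2)(ζ(z+p) + ζ(z−p)) and g = φ_{a,c}' + φ_{a,c}² − q(·;A), the function g has at most a simple pole at z = p, with residue A − (℘'(p) + ℘'(a₁))/(2(℘(p) − ℘(a₁))) − (℘'(p) + ℘'(a₂))/(2(℘(p) − ℘(a₂))) + ℘''(p)/(4℘'(p)), and at most a simple pole at z = −p, with residue −(A − (℘'(p) − ℘'(a₁))/(2(℘(p) − ℘(a₁))) − (℘'(p) − ℘'(a₂))/(2(℘(p) − ℘(a₂))) + ℘''(p)/(4℘'(p))). -/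

import Mathlib

open Complex Filter Topology

noncomputable section

/-- The lattice `Λ_τ = ℤ + τℤ`. -/
def Lam (τ : ℂ) : Set ℂ := {ω | ∃ m n : ℤ, ω = (m : ℂ) + (n : ℂ) * τ}

/-- The nonzero lattice points. -/
def Lam' (τ : ℂ) : Set ℂ := {ω | ω ∈ Lam τ ∧ ω ≠ 0}

/-- The Weierstrass elliptic function `℘(z; τ)`. -/
def wp (τ z : ℂ) : ℂ :=
  1 / z ^ 2 + ∑' ω : Lam' τ, (1 / (z - (ω : ℂ)) ^ 2 - 1 / (ω : ℂ) ^ 2)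

/-- The Weierstrass zeta function `ζ(z; τ)`. -/
def wzeta (τ z : ℂ) : ℂ :=
  1 / z + ∑' ω : Lam' τ, (1 / (z - (ω : ℂ)) + 1 / (ω : ℂ) + z / (ω : ℂ) ^ 2)

/-- The Weierstrass sigma function `σ(z; τ)`. -/
def wsigma (τ z : ℂ) : ℂ :=
  z * ∏' ω : Lam' τ,
    ((1 - z / (ω : ℂ)) * Complex.exp (z / (ω : ℂ) + z ^ 2 / (2 * (ω : ℂ) ^ 2)))

/-- `℘'(z; τ)`. -/
def wpd (τ : ℂ) : ℂ → ℂ := deriv (wp τ)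

/-- `℘''(z; τ)`. -/
def wpdd (τ : ℂ) : ℂ → ℂ := deriv (deriv (wp τ))

/-- The constant `B(A)`. -/
def Bc (τ p A : ℂ) : ℂ :=
  A ^ 2 - wzeta τ (2 * p) * A - 3 / 4 * wp τ (2 * p) - 2 * wp τ p

/-- The potential `q(z; A)`. -/
def qpot (τ p A z : ℂ) : ℂ :=
  2 * wp τ z + 3 / 4 * (wp τ (z + p) + wp τ (z - p))
    + A * (wzeta τ (z + p) - wzeta τ (z - p)) + Bc τ p A

/-- The singular set `S = Λ_τ ∪ (p + Λ_τ) ∪ (−p + Λ_τ)`. -/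
def Sset (τ p : ℂ) : Set ℂ :=
  Lam τ ∪ {z | z - p ∈ Lam τ} ∪ {z | z + p ∈ Lam τ}

/-- The unique elliptic solution `Φ_e(z; A)` of the second symmetric product equation. -/
def Phie (τ p A z : ℂ) : ℂ :=
  wp τ z + (A / 2 - 3 * wpdd τ p / (8 * wpd τ p)) * (wzeta τ (z + p) - wzeta τ (z - p))
    - A ^ 2 + (wpdd τ p / (2 * wpd τ p) - wzeta τ p) * A
    - wp τ p + 3 / 4 * (wpdd τ p / wpd τ p) * wzeta τ p
    + 3 / 16 * (wpdd τ p ^ 2 / wpd τ p ^ 2)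

/-- The cubic factor `Y₁(A)`. -/
def Y1 (τ p A : ℂ) : ℂ :=
  A ^ 3 - 5 * wpdd τ p / (4 * wpd τ p) * A ^ 2
    + 3 * (wp τ p + wpdd τ p ^ 2 / (16 * wpd τ p ^ 2)) * A
    + wpd τ p / 2 - 9 * wpdd τ p / (4 * wpd τ p) * wp τ p
    + 9 / 64 * (wpdd τ p ^ 3 / wpd τ p ^ 3)

/-- The cubic factor `Y₂(A)`. -/
def Y2 (τ p A : ℂ) : ℂ :=
  A ^ 3 - wpdd τ p / (4 * wpd τ p) * A ^ 2
    - 5 / 16 * (wpdd τ p ^ 2 / wpd τ p ^ 2) * A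
    + 2 * wpd τ p - 3 / 64 * (wpdd τ p ^ 3 / wpd τ p ^ 3)

/-- The logarithmic derivative `φ_{a,c} = y_{a,c}'/y_{a,c}`. -/
def phiac (τ p a₁ a₂ c z : ℂ) : ℂ :=
  c + wzeta τ (z - a₁) + wzeta τ (z - a₂) - wzeta τ z
    - 1 / 2 * (wzeta τ (z + p) + wzeta τ (z - p))

/-- The error function `g = φ_{a,c}' + φ_{a,c}² − q(·;A)`. -/
def gfun (τ p a₁ a₂ c A z : ℂ) : ℂ :=
  deriv (phiac τ p a₁ a₂ c) z + (phiac τ p a₁ a₂ c z) ^ 2 - qpot τ p A z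

namespace PeriodPair

variable (L : PeriodPair)

/-- The Weierstrass zeta function with the term at the origin missing. -/
def zetaExcept (z : ℂ) : ℂ :=
  ∑' l : L.lattice, if l.1 = 0 then 0 else (1 / (z - l) + 1 / l + z / l ^ 2)

/-- The Weierstrass zeta function of the lattice of a pair of periods. -/
def zeta (z : ℂ) : ℂ := 1 / z + L.zetaExcept z

lemma zeta_summand_bound (r : ℝ) (s : ℂ) (hs : ‖s‖ < r) (l : ℂ)
    (hl : l ≠ 0) (h : 2 * r ≤ ‖l‖) :
    ‖1 / (s - l) + 1 / l + s / l ^ 2‖ ≤ 2 * r ^ 2 * ‖l‖ ^ (-3 : ℝ) := by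
  have hl' : 0 < ‖l‖ := by simpa
  have hsl : ‖l‖ / 2 ≤ ‖s - l‖ := by
    rw [norm_sub_rev]
    exact le_trans (by linarith) (norm_sub_norm_le l s)
  have hsl0 : s - l ≠ 0 := norm_pos_iff.mp (by linarith)
  have e : 1 / (s - l) + 1 / l + s / l ^ 2 = s ^ 2 / ((s - l) * l ^ 2) := by
    field_simp
    ring
  rw [e, norm_div, norm_mul, norm_pow, norm_pow]
  calc ‖s‖ ^ 2 / (‖s - l‖ * ‖l‖ ^ 2) ≤ r ^ 2 / (‖l‖ / 2 * ‖l‖ ^ 2) := by gcongr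
    _ = 2 * r ^ 2 / ‖l‖ ^ 3 := by field
    _ = _ := by norm_cast

lemma hasSumLocallyUniformly_zetaExcept :
    HasSumLocallyUniformly
      (fun (l : L.lattice) (z : ℂ) ↦ if l.1 = 0 then 0 else (1 / (z - l) + 1 / l + z / l ^ 2))
      L.zetaExcept := by
  refine L.hasSumLocallyUniformly_aux (u := fun r l ↦ 2 * r ^ 2 * ‖l‖ ^ (-3 : ℝ)) _
    (fun _ _ ↦ (ZLattice.summable_norm_rpow _ _ (by simp; norm_num)).mul_left _) fun r hr ↦
    Filter.eventually_atTop.mpr ⟨2 * r, ?_⟩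
  rintro _ h s hs l rfl
  split_ifs with hl
  · simpa using! show 0 ≤ 2 * r ^ 2 * (‖l.1‖ ^ 3)⁻¹ by positivity
  · exact zeta_summand_bound r s hs l hl h

lemma differentiableOn_zetaExcept :
    DifferentiableOn ℂ L.zetaExcept (L.lattice \ {0})ᶜ := by
  refine L.hasSumLocallyUniformly_zetaExcept.hasSumLocallyUniformlyOn.differentiableOn
    (.of_forall fun s ↦ .fun_sum fun i hi ↦ ?_) L.isOpen_compl_lattice_sdiff
  split_ifs
  · simp
  · refine .add (.add (.div (by fun_prop) (by fun_prop) fun x hx ↦ ?_) (by fun_prop))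
      (by fun_prop)
    have : x ≠ i := by rintro rfl; simp_all
    simpa [sub_eq_zero]

lemma deriv_zetaExcept {z : ℂ} (hz : z ∈ ((L.lattice : Set ℂ) \ {0})ᶜ) :
    deriv L.zetaExcept z = -L.weierstrassPExcept 0 z := by
  have key : Set.EqOn (deriv L.zetaExcept) (fun z ↦ -L.weierstrassPExcept 0 z)
      ((L.lattice : Set ℂ) \ {0})ᶜ := by
    have hne : ∀ x ∈ ((L.lattice : Set ℂ) \ {0})ᶜ, ∀ l : L.lattice, l.1 ≠ 0 → x - l ≠ 0 := by
      intro x hx l hl e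
      obtain rfl := sub_eq_zero.mp e
      simp_all
    refine (L.hasSumLocallyUniformly_zetaExcept.tendstoLocallyUniformlyOn.deriv
      (.of_forall fun s ↦ ?_) L.isOpen_compl_lattice_sdiff).unique ?_
    · refine .fun_sum fun i hi ↦ ?_
      split_ifs with hl
      · simp
      · exact .add (.add (.div (by fun_prop) (by fun_prop) fun x hx ↦ hne x hx i hl)
          (by fun_prop)) (by fun_prop)
    · refine ((L.hasSumLocallyUniformly_weierstrassPExcept 0).tendstoLocallyUniformlyOn
        (s := ((L.lattice : Set ℂ) \ {0})ᶜ)).fun_neg.congr ?_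
      intro s x hx
      have hd : ∀ i : L.lattice, HasDerivAt
          (fun z : ℂ ↦ if i.1 = 0 then 0 else (1 / (z - i) + 1 / i + z / i ^ 2))
          (-(if i.1 = 0 then 0 else (1 / (x - i) ^ 2 - 1 / i ^ 2))) x := by
        intro i
        split_ifs with hl
        · simpa using hasDerivAt_const x (0 : ℂ)
        · have h0 := hne x hx i hl
          have := ((((hasDerivAt_id x).sub_const i.1).inv h0).add_const (1 / i.1)).add
            ((hasDerivAt_id x).div_const (i.1 ^ 2))
          convert! this using 1
          · ext; simp
          · simp only [id]; ring
      simp only [Function.comp_apply]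
      rw [(HasDerivAt.fun_sum fun i _ ↦ hd i).deriv, Finset.sum_neg_distrib]
  exact key hz

lemma zetaExcept_neg (z : ℂ) : L.zetaExcept (-z) = -L.zetaExcept z := by
  simp only [zetaExcept]
  rw [← (Equiv.neg L.lattice).tsum_eq, ← tsum_neg]
  congr with l
  by_cases hl : l.1 = 0
  · simp [hl]
  · simp only [Equiv.neg_apply, NegMemClass.coe_neg, neg_eq_zero, hl, if_false]
    rw [show -z - -l.1 = -(z - l) by ring, neg_sq, one_div_neg_eq_neg_one_div,
      one_div_neg_eq_neg_one_div]
    ring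

lemma zeta_neg (z : ℂ) : L.zeta (-z) = -L.zeta z := by
  rw [zeta, zeta, zetaExcept_neg, one_div_neg_eq_neg_one_div]
  ring

lemma zetaExcept_zero : L.zetaExcept 0 = 0 := by
  simpa [CharZero.eq_neg_self_iff] using L.zetaExcept_neg 0

lemma weierstrassPExcept_zero_zero : L.weierstrassPExcept 0 0 = 0 := by
  simp

lemma weierstrassP_eq (z : ℂ) : L.weierstrassP z = 1 / z ^ 2 + L.weierstrassPExcept 0 z := by
  have := L.weierstrassPExcept_add 0 z
  simp at this
  rw [← this]; simp; ring

lemma derivWeierstrassP_eq (z : ℂ) :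
    L.derivWeierstrassP z = -2 / z ^ 3 + L.derivWeierstrassPExcept 0 z := by
  have := L.derivWeierstrassPExcept_sub 0 z
  simp at this
  rw [← this]; ring

lemma analyticAt_zetaExcept : AnalyticAt ℂ L.zetaExcept 0 :=
  L.differentiableOn_zetaExcept.analyticAt (L.compl_lattice_sdiff_singleton_mem_nhds 0)

lemma hasDerivAt_zeta {z : ℂ} (hz : z ∉ L.lattice) :
    HasDerivAt L.zeta (-L.weierstrassP z) z := by
  have hz' : z ∈ ((L.lattice : Set ℂ) \ {0})ᶜ := by simp [hz]
  have hz0 : z ≠ 0 := by rintro rfl; simp at hz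
  have h := (L.differentiableOn_zetaExcept.differentiableAt
    (L.isOpen_compl_lattice_sdiff.mem_nhds hz')).hasDerivAt
  rw [L.deriv_zetaExcept hz'] at h
  have := (hasDerivAt_inv hz0).add h
  convert! this using 1
  · ext; simp [zeta]
  · rw [weierstrassP_eq]; ring

lemma compl_lattice_mem_nhds {z : ℂ} (hz : z ∉ L.lattice) : (L.lattice : Set ℂ)ᶜ ∈ 𝓝 z :=
  L.isClosed_lattice.isOpen_compl.mem_nhds hz

lemma analyticAt_zeta {z : ℂ} (hz : z ∉ L.lattice) : AnalyticAt ℂ L.zeta z :=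
  DifferentiableOn.analyticAt (s := (L.lattice : Set ℂ)ᶜ)
    (fun _ hw ↦ (L.hasDerivAt_zeta hw).differentiableAt.differentiableWithinAt)
    (L.compl_lattice_mem_nhds hz)

lemma analyticAt_zeta_add {x y : ℂ} (hxy : x + y ∉ L.lattice) :
    AnalyticAt ℂ (fun z ↦ L.zeta (z + y)) x :=
  AnalyticAt.fun_comp (g := L.zeta) (f := fun z ↦ z + y) (L.analyticAt_zeta hxy) (by fun_prop)

lemma isPreconnected_compl_lattice : IsPreconnected (L.lattice : Set ℂ)ᶜ :=
  (Set.Countable.isConnected_compl_of_one_lt_rank (by simp)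
    (countable_of_Lindelof_of_discrete (X := L.lattice))).2

lemma exists_zeta_add_coe (l : L.lattice) :
    ∃ η, ∀ z ∉ L.lattice, L.zeta (z + l) = L.zeta z + η := by
  have hl : ∀ z ∉ L.lattice, z + l.1 ∉ L.lattice := fun z hz h ↦
    hz (by simpa using sub_mem h l.2)
  have hd : ∀ z ∉ L.lattice, HasDerivAt (fun z ↦ L.zeta (z + l) - L.zeta z) 0 z := by
    intro z hz
    have := ((L.hasDerivAt_zeta (hl z hz)).comp_add_const z l.1).sub (L.hasDerivAt_zeta hz)
    simpa using! this
  obtain ⟨η, h⟩ := L.isClosed_lattice.isOpen_compl.exists_is_const_of_deriv_eq_zero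
    L.isPreconnected_compl_lattice
    (fun z hz ↦ (hd z hz).differentiableAt.differentiableWithinAt) (fun z hz ↦ (hd z hz).deriv)
  exact ⟨η, fun z hz ↦ by rw [← h z hz]; ring⟩

lemma exists_zeta_add_add_coe {x y : ℂ} (hx : x ∉ L.lattice) (hxy : x + y ∉ L.lattice)
    (l : L.lattice) :
    L.zeta (x + l + y) - L.zeta (x + l) = L.zeta (x + y) - L.zeta x := by
  obtain ⟨η, hη⟩ := L.exists_zeta_add_coe l
  rw [add_right_comm, hη _ hx, hη _ hxy]
  ring

end PeriodPair

lemma tendsto_div_sq_of_deriv_eq_zero {f : ℂ → ℂ} (hf : AnalyticAt ℂ f 0) (h0 : f 0 = 0)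
    (h1 : deriv f 0 = 0) (h2 : deriv (deriv f) 0 = 0) :
    Tendsto (fun x ↦ f x / x ^ 2) (𝓝[≠] 0) (𝓝 0) := by
  have h3 : ((3 : ℕ) : ℕ∞) ≤ analyticOrderAt f 0 := by
    rw [natCast_le_analyticOrderAt_iff_iteratedDeriv_eq_zero hf]
    intro i hi
    interval_cases i <;> simp [iteratedDeriv_succ, h0, h1, h2]
  obtain ⟨g, hg, he⟩ := (natCast_le_analyticOrderAt hf).mp h3
  have ht : Tendsto (fun x ↦ x * g x) (𝓝[≠] 0) (𝓝 0) := by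
    have : ContinuousAt (fun x ↦ x * g x) 0 := continuousAt_id.mul hg.continuousAt
    simpa using! this.tendsto.mono_left nhdsWithin_le_nhds
  refine ht.congr' ?_
  filter_upwards [he.filter_mono nhdsWithin_le_nhds, self_mem_nhdsWithin] with x hx hx0
  have : x ≠ 0 := hx0
  rw [hx, sub_zero, smul_eq_mul]
  field_simp

lemma eventually_eq_zero_of_deriv_eq_mul {f g : ℂ → ℂ} {x : ℂ} (hf : AnalyticAt ℂ f x)
    (hg : AnalyticAt ℂ g x) (hx : f x = 0) (h : deriv f =ᶠ[𝓝 x] fun z ↦ g z * f z) :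
    ∀ᶠ z in 𝓝 x, f z = 0 := by
  rw [← analyticOrderAt_eq_top]
  have h1 := hf.analyticOrderAt_deriv_add_one
  have h2 : analyticOrderAt (deriv f) x = analyticOrderAt g x + analyticOrderAt f x :=
    (analyticOrderAt_congr h).trans (analyticOrderAt_mul hg hf)
  simp only [hx, sub_zero] at h1
  rw [h2] at h1
  by_contra hne
  have h3 : analyticOrderAt f x + 1 ≤ analyticOrderAt f x :=
    calc analyticOrderAt f x + 1 ≤ analyticOrderAt g x + analyticOrderAt f x + 1 := by
          gcongr; exact le_add_self
      _ = _ := h1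
  exact ((ENat.add_one_le_iff hne).mp h3).false

namespace PeriodPair

variable (L : PeriodPair)

lemma not_eqOn_weierstrassP_const (c : ℂ) : ¬ ∀ z ∉ L.lattice, L.weierstrassP z = c := by
  intro h
  have h1 : L.weierstrassP =ᶠ[𝓝[≠] 0] fun _ ↦ c := by
    filter_upwards [nhdsWithin_le_nhds (L.compl_lattice_sdiff_singleton_mem_nhds 0),
      self_mem_nhdsWithin] with z hz hz0
    exact h z fun hz' ↦ hz ⟨hz', hz0⟩
  have h2 := L.order_weierstrassP 0 (zero_mem _)
  rw [meromorphicOrderAt_congr h1, meromorphicOrderAt_const] at h2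
  split_ifs at h2
  · exact absurd h2 (by decide)
  · exact absurd h2 (by decide)

open scoped Classical in
/-- The defect in the addition formula for the zeta function, with denominators cleared. -/
def additionDefect (y x : ℂ) : ℂ :=
  if x ∈ L.lattice ∨ x + y ∈ L.lattice then 0 else
    (L.weierstrassP x - L.weierstrassP y) * (L.zeta (x + y) - L.zeta x - L.zeta y)
      - 1 / 2 * (L.derivWeierstrassP x - L.derivWeierstrassP y)

lemma additionDefect_add_coe (y x : ℂ) (l : L.lattice) :
    L.additionDefect y (x + l) = L.additionDefect y x := by
  have h (z : ℂ) : z + l.1 ∈ L.lattice ↔ z ∈ L.lattice :=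
    L.lattice.toAddSubgroup.add_mem_cancel_right (y := z) l.2
  by_cases hx : x ∈ L.lattice ∨ x + y ∈ L.lattice
  · rw [additionDefect, additionDefect, if_pos hx, if_pos (by rwa [add_right_comm, h, h])]
  · rw [additionDefect, additionDefect, if_neg hx, if_neg (by rwa [add_right_comm, h, h])]
    push Not at hx
    rw [L.exists_zeta_add_add_coe hx.1 hx.2, weierstrassP_add_coe, derivWeierstrassP_add_coe]

lemma tendsto_additionDefect_zero {y : ℂ} (hy : y ∉ L.lattice) :
    Tendsto (fun x ↦ (L.weierstrassP x - L.weierstrassP y) * (L.zeta (x + y) - L.zeta x - L.zeta y)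
      - 1 / 2 * (L.derivWeierstrassP x - L.derivWeierstrassP y)) (𝓝[≠] 0) (𝓝 0) := by
  have hP := L.analyticAt_weierstrassPExcept 0
  have hP' := L.analyticAt_derivWeierstrassPExcept 0
  have hP0 := L.weierstrassPExcept_zero_zero
  have hR := L.analyticAt_zetaExcept
  have hPd : deriv (L.weierstrassPExcept 0) 0 = 0 := by simp
  have hRd : deriv L.zetaExcept 0 = 0 := by
    rw [L.deriv_zetaExcept (by simp), hP0, neg_zero]
  have hRdd : deriv (deriv L.zetaExcept) 0 = 0 := by
    have : deriv L.zetaExcept =ᶠ[𝓝 0] fun z ↦ -L.weierstrassPExcept 0 z := by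
      filter_upwards [L.compl_lattice_sdiff_singleton_mem_nhds 0] with z hz
      exact L.deriv_zetaExcept hz
    rw [this.deriv_eq, deriv.fun_neg, hPd, neg_zero]
  have t1 : Tendsto (fun x ↦ L.zetaExcept x / x ^ 2) (𝓝[≠] 0) (𝓝 0) :=
    tendsto_div_sq_of_deriv_eq_zero hR L.zetaExcept_zero hRd hRdd
  have t2 : Tendsto (fun x ↦ L.weierstrassPExcept 0 x / x) (𝓝[≠] 0) (𝓝 0) := by
    have := hP.differentiableAt.hasDerivAt.tendsto_slope
    rw [hPd] at this
    refine this.congr fun x ↦ ?_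
    simp [slope_def_field, hP0]
  have hyU : ∀ᶠ x in 𝓝 (0 : ℂ), x + y ∉ L.lattice := by
    have : ContinuousAt (fun x ↦ x + y) 0 := by fun_prop
    exact this.eventually_mem (by simpa using L.compl_lattice_mem_nhds hy)
  have hζ : AnalyticAt ℂ (fun x ↦ L.zeta (x + y)) 0 :=
    L.analyticAt_zeta_add (by simpa using hy)
  have hζd : ∀ᶠ x in 𝓝 (0 : ℂ), HasDerivAt (fun x ↦ L.zeta (x + y)) (-L.weierstrassP (x + y)) x :=
    hyU.mono fun x hx ↦ (L.hasDerivAt_zeta hx).comp_add_const x y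
  let T : ℂ → ℂ := fun x ↦ L.zeta (x + y) - L.zeta y + L.weierstrassP y * x
    + 1 / 2 * L.derivWeierstrassP y * x ^ 2
  have hT : AnalyticAt ℂ T 0 := by fun_prop
  have hTd : ∀ᶠ x in 𝓝 (0 : ℂ), HasDerivAt T (-L.weierstrassP (x + y) + L.weierstrassP y
      + L.derivWeierstrassP y * x) x := by
    filter_upwards [hζd] with x hx
    have := ((hx.sub_const (L.zeta y)).add ((hasDerivAt_id x).const_mul (L.weierstrassP y))).add
      ((hasDerivAt_pow 2 x).const_mul (1 / 2 * L.derivWeierstrassP y))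
    convert! this using 1
    simp
    ring
  have hTdd : deriv (deriv T) 0 = 0 := by
    have e : deriv T =ᶠ[𝓝 0] _ := hTd.mono fun x hx ↦ hx.deriv
    have h1 : HasDerivAt (fun x ↦ L.weierstrassP (x + y)) (L.derivWeierstrassP y) 0 := by
      have := (L.analyticOnNhd_weierstrassP y hy).differentiableAt.hasDerivAt
      rw [deriv_weierstrassP] at this
      exact HasDerivAt.comp_add_const 0 y (by simpa using this)
    have h2 := (h1.neg.add_const (L.weierstrassP y)).add
      ((hasDerivAt_id (0 : ℂ)).const_mul (L.derivWeierstrassP y))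
    rw [e.deriv_eq]
    have := h2.deriv
    simpa using! this
  have t3 : Tendsto (fun x ↦ T x / x ^ 2) (𝓝[≠] 0) (𝓝 0) :=
    tendsto_div_sq_of_deriv_eq_zero hT (by simp [T]) (by simp [hTd.self_of_nhds.deriv]) hTdd
  have t4 : Tendsto (fun x ↦ (L.weierstrassPExcept 0 x - L.weierstrassP y) *
      (L.zeta (x + y) - L.zeta y - L.zetaExcept x) - 1 / 2 * L.derivWeierstrassPExcept 0 x)
      (𝓝[≠] 0) (𝓝 0) := by
    have : ContinuousAt (fun x ↦ (L.weierstrassPExcept 0 x - L.weierstrassP y) *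
      (L.zeta (x + y) - L.zeta y - L.zetaExcept x) - 1 / 2 * L.derivWeierstrassPExcept 0 x) 0 :=
      AnalyticAt.continuousAt (𝕜 := ℂ) (by fun_prop)
    simpa [L.zetaExcept_zero] using! this.tendsto.mono_left nhdsWithin_le_nhds
  have := ((t3.sub t1).sub t2).add t4
  simp only [sub_zero, add_zero] at this
  refine this.congr' ?_
  filter_upwards [self_mem_nhdsWithin] with x hx
  have hx0 : x ≠ 0 := hx
  simp only [T]
  rw [L.weierstrassP_eq x, L.derivWeierstrassP_eq x, zeta.eq_def L x]
  field_simp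
  ring

lemma tendsto_mul_zeta : Tendsto (fun x ↦ x * L.zeta x) (𝓝[≠] 0) (𝓝 1) := by
  have : ContinuousAt (fun x ↦ 1 + x * L.zetaExcept x) 0 := by
    have := L.analyticAt_zetaExcept.continuousAt
    fun_prop
  have h := this.tendsto.mono_left (nhdsWithin_le_nhds (s := {0}ᶜ))
  simp only [zero_mul, add_zero] at h
  refine h.congr' ?_
  filter_upwards [self_mem_nhdsWithin] with x hx
  have hx0 : x ≠ 0 := hx
  rw [zeta]
  field_simp

lemma tendsto_additionDefect_neg {y : ℂ} (hy : y ∉ L.lattice) :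
    Tendsto (fun x ↦ (L.weierstrassP x - L.weierstrassP y) * (L.zeta (x + y) - L.zeta x - L.zeta y)
      - 1 / 2 * (L.derivWeierstrassP x - L.derivWeierstrassP y)) (𝓝[≠] (-y)) (𝓝 0) := by
  have hy' : -y ∉ L.lattice := by simpa
  have hP := L.analyticOnNhd_weierstrassP _ hy'
  have hP' := L.analyticOnNhd_derivWeierstrassP _ hy'
  have hζ := L.analyticAt_zeta hy'
  have hs := hP.differentiableAt.hasDerivAt.tendsto_slope
  rw [deriv_weierstrassP, derivWeierstrassP_neg] at hs
  have hm : Tendsto (fun x ↦ x + y) (𝓝[≠] (-y)) (𝓝[≠] 0) := by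
    refine tendsto_nhdsWithin_iff.mpr ⟨?_, ?_⟩
    · have : ContinuousAt (fun x ↦ x + y) (-y) := by fun_prop
      simpa using! this.tendsto.mono_left (nhdsWithin_le_nhds (s := {-y}ᶜ))
    · filter_upwards [self_mem_nhdsWithin] with x hx
      simpa [add_eq_zero_iff_eq_neg] using hx
  have t1 := hs.mul (L.tendsto_mul_zeta.comp hm)
  have t2 : Tendsto (fun x ↦ (L.weierstrassP x - L.weierstrassP y) * (-L.zeta x - L.zeta y)
      - 1 / 2 * (L.derivWeierstrassP x - L.derivWeierstrassP y)) (𝓝[≠] (-y))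
      (𝓝 (L.derivWeierstrassP y)) := by
    have : ContinuousAt (fun x ↦ (L.weierstrassP x - L.weierstrassP y) * (-L.zeta x - L.zeta y)
      - 1 / 2 * (L.derivWeierstrassP x - L.derivWeierstrassP y)) (-y) :=
      AnalyticAt.continuousAt (𝕜 := ℂ) (by fun_prop)
    have h := this.tendsto.mono_left (nhdsWithin_le_nhds (s := {-y}ᶜ))
    simp only [weierstrassP_neg, derivWeierstrassP_neg] at h
    convert! h using 2
    ring
  have := t1.add t2
  simp only [mul_one, neg_add_cancel] at this
  refine this.congr' ?_
  filter_upwards [self_mem_nhdsWithin] with x hx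
  have hx0 : x + y ≠ 0 := by simpa [add_eq_zero_iff_eq_neg] using hx
  simp only [slope_def_field, Function.comp_apply, weierstrassP_neg, sub_neg_eq_add]
  field_simp
  ring

lemma analyticAt_additionDefect_aux {y x : ℂ} (hx : x ∉ L.lattice) (hy : x + y ∉ L.lattice) :
    AnalyticAt ℂ (L.additionDefect y) x := by
  have h1 := L.analyticOnNhd_weierstrassP x hx
  have h2 := L.analyticOnNhd_derivWeierstrassP x hx
  have h3 := L.analyticAt_zeta hx
  have h4 : AnalyticAt ℂ (fun x ↦ L.zeta (x + y)) x :=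
    L.analyticAt_zeta_add hy
  have h5 : AnalyticAt ℂ (fun x ↦
    (L.weierstrassP x - L.weierstrassP y) * (L.zeta (x + y) - L.zeta x - L.zeta y)
      - 1 / 2 * (L.derivWeierstrassP x - L.derivWeierstrassP y)) x := by fun_prop
  have hc : ContinuousAt (fun x ↦ x + y) x := by fun_prop
  refine h5.congr ?_
  filter_upwards [L.compl_lattice_mem_nhds hx, hc.eventually_mem (L.compl_lattice_mem_nhds hy)]
    with z hz hz'
  rw [additionDefect, if_neg]
  exact not_or.mpr ⟨hz, hz'⟩

/-- If `w` represents one of the two classes of excluded points, a limit `0` of the formula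
makes `additionDefect` analytic there. -/
lemma analyticAt_additionDefect_of_tendsto {y w : ℂ} (hw : w ∈ L.lattice ∨ w + y ∈ L.lattice)
    (h : Tendsto (fun x ↦ (L.weierstrassP x - L.weierstrassP y) *
      (L.zeta (x + y) - L.zeta x - L.zeta y)
      - 1 / 2 * (L.derivWeierstrassP x - L.derivWeierstrassP y)) (𝓝[≠] w) (𝓝 0)) :
    AnalyticAt ℂ (L.additionDefect y) w := by
  have hc : Tendsto (fun x ↦ x + y) (𝓝 w) (𝓝 (w + y)) :=
    (by fun_prop : Continuous fun x ↦ x + y).tendsto w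
  have hev : ∀ᶠ x in 𝓝[≠] w, x ∉ L.lattice ∧ x + y ∉ L.lattice := by
    filter_upwards [nhdsWithin_le_nhds (L.compl_lattice_sdiff_singleton_mem_nhds w),
      nhdsWithin_le_nhds (hc (L.compl_lattice_sdiff_singleton_mem_nhds (w + y))),
      self_mem_nhdsWithin] with x h1 h2 h3
    have h3' : x ≠ w := h3
    exact ⟨fun h ↦ h1 ⟨h, h3'⟩, fun h ↦ h2 ⟨h, by simpa using h3'⟩⟩
  refine analyticAt_of_differentiable_on_punctured_nhds_of_continuousAt
    (hev.mono fun x hx ↦ (L.analyticAt_additionDefect_aux hx.1 hx.2).differentiableAt) ?_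
  rw [continuousAt_iff_punctured_nhds]
  have h0 : L.additionDefect y w = 0 := if_pos hw
  rw [h0]
  refine h.congr' (hev.mono fun x hx ↦ ?_)
  rw [additionDefect, if_neg (not_or.mpr hx)]

lemma analyticAt_additionDefect {y : ℂ} (hy : y ∉ L.lattice) (x : ℂ) :
    AnalyticAt ℂ (L.additionDefect y) x := by
  have key (w : ℂ) (l : L.lattice) (hw : AnalyticAt ℂ (L.additionDefect y) w) :
      AnalyticAt ℂ (L.additionDefect y) (w + l) := by
    have := AnalyticAt.fun_comp (f := fun x ↦ x - l.1) (x := w + l) (g := L.additionDefect y)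
      (by simpa using hw) (by fun_prop)
    refine this.congr (.of_forall fun z ↦ ?_)
    dsimp only
    rw [← L.additionDefect_add_coe y _ l, sub_add_cancel]
  by_cases hx : x ∈ L.lattice
  · simpa using key 0 ⟨x, hx⟩ (L.analyticAt_additionDefect_of_tendsto (by simp)
      (L.tendsto_additionDefect_zero hy))
  by_cases hxy : x + y ∈ L.lattice
  · simpa using key (-y) ⟨x + y, hxy⟩ (L.analyticAt_additionDefect_of_tendsto (by simp)
      (L.tendsto_additionDefect_neg hy))
  exact L.analyticAt_additionDefect_aux hx hxy

lemma additionDefect_eq_zero {y : ℂ} (hy : y ∉ L.lattice) (x : ℂ) : L.additionDefect y x = 0 := by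
  have : Differentiable ℂ (L.additionDefect y) :=
    fun x ↦ (L.analyticAt_additionDefect hy x).differentiableAt
  exact (this.apply_eq_apply_of_bounded (IsZLattice.isCompact_range_of_periodic L.lattice _
    this.continuous fun z w hw ↦ L.additionDefect_add_coe y z ⟨w, hw⟩).isBounded x 0).trans
    (if_pos (by simp))

/-- The addition formula for the zeta function, with denominators cleared. -/
lemma weierstrassP_sub_mul_zeta_add_sub {x y : ℂ} (hx : x ∉ L.lattice) (hy : y ∉ L.lattice)
    (hxy : x + y ∉ L.lattice) :
    (L.weierstrassP x - L.weierstrassP y) * (L.zeta (x + y) - L.zeta x - L.zeta y) =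
      1 / 2 * (L.derivWeierstrassP x - L.derivWeierstrassP y) := by
  have := L.additionDefect_eq_zero hy x
  rwa [additionDefect, if_neg (not_or.mpr ⟨hx, hxy⟩), sub_eq_zero] at this

lemma weierstrassP_ne_of_derivWeierstrassP_eq_zero {x y : ℂ} (hx : x ∉ L.lattice)
    (hy : y ∉ L.lattice) (hxy : x + y ∉ L.lattice) (h0 : L.derivWeierstrassP y = 0) :
    L.weierstrassP x ≠ L.weierstrassP y := by
  intro h
  have h1 := L.analyticOnNhd_weierstrassP x hx
  have h3 := L.analyticAt_zeta hx
  have h4 : AnalyticAt ℂ (fun x ↦ L.zeta (x + y)) x :=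
    L.analyticAt_zeta_add hxy
  have hc : ContinuousAt (fun x ↦ x + y) x := by fun_prop
  have := eventually_eq_zero_of_deriv_eq_mul (f := fun z ↦ L.weierstrassP z - L.weierstrassP y)
    (g := fun z ↦ 2 * (L.zeta (z + y) - L.zeta z - L.zeta y)) (x := x) (by fun_prop) (by fun_prop)
    (by simp [h]) (by
      filter_upwards [L.compl_lattice_mem_nhds hx,
        hc.eventually_mem (L.compl_lattice_mem_nhds hxy)] with z hz hz'
      have := L.weierstrassP_sub_mul_zeta_add_sub hz hy hz'
      rw [deriv_sub_const, deriv_weierstrassP]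
      rw [h0] at this
      linear_combination -2 * this)
  refine L.not_eqOn_weierstrassP_const (L.weierstrassP y) fun z hz ↦ sub_eq_zero.mp ?_
  exact AnalyticOnNhd.eqOn_zero_of_preconnected_of_eventuallyEq_zero
    (f := fun z ↦ L.weierstrassP z - L.weierstrassP y) (U := (L.lattice : Set ℂ)ᶜ)
    (fun w hw ↦ (L.analyticOnNhd_weierstrassP w hw).sub analyticAt_const)
    L.isPreconnected_compl_lattice hx this hz

lemma weierstrassP_ne {x y : ℂ} (hx : x ∉ L.lattice) (hy : y ∉ L.lattice)
    (hxy : x + y ∉ L.lattice) (hxy' : x - y ∉ L.lattice) :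
    L.weierstrassP x ≠ L.weierstrassP y := by
  intro h
  have h1 := L.weierstrassP_sub_mul_zeta_add_sub hx hy hxy
  have h2 := L.weierstrassP_sub_mul_zeta_add_sub hx (y := -y) (by simpa) (by simpa [← sub_eq_add_neg])
  rw [weierstrassP_neg, derivWeierstrassP_neg] at h2
  rw [h, sub_self, zero_mul] at h1 h2
  exact L.weierstrassP_ne_of_derivWeierstrassP_eq_zero hx hy hxy
    (by linear_combination h1 - h2) h

lemma derivWeierstrassP_ne_zero {y : ℂ} (hy : y ∉ L.lattice) (hy2 : 2 * y ∉ L.lattice) :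
    L.derivWeierstrassP y ≠ 0 := fun h ↦
  L.weierstrassP_ne_of_derivWeierstrassP_eq_zero hy hy (by rwa [← two_mul]) h rfl

/-- The addition formula for the zeta function. -/
lemma zeta_add {x y : ℂ} (hx : x ∉ L.lattice) (hy : y ∉ L.lattice)
    (hxy : x + y ∉ L.lattice) (hxy' : x - y ∉ L.lattice) :
    L.zeta (x + y) = L.zeta x + L.zeta y + (L.derivWeierstrassP x - L.derivWeierstrassP y) /
      (2 * (L.weierstrassP x - L.weierstrassP y)) := by
  have h := L.weierstrassP_sub_mul_zeta_add_sub hx hy hxy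
  have h0 := sub_ne_zero.mpr (L.weierstrassP_ne hx hy hxy hxy')
  field_simp
  linear_combination 2 * h

/-- The duplication formula for the zeta function. -/
lemma zeta_two_mul {y : ℂ} (hy : y ∉ L.lattice) (hy2 : 2 * y ∉ L.lattice) :
    L.zeta (2 * y) = L.zeta y + L.zeta y + deriv L.derivWeierstrassP y / (2 * L.derivWeierstrassP y) := by
  have h0 := L.derivWeierstrassP_ne_zero hy hy2
  rw [two_mul] at hy2 ⊢
  have hP := (L.analyticOnNhd_weierstrassP y hy).differentiableAt.hasDerivAt
  rw [deriv_weierstrassP] at hP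
  have hP' := (L.analyticOnNhd_derivWeierstrassP y hy).differentiableAt.hasDerivAt
  have hζ := ((L.hasDerivAt_zeta hy2).comp_add_const y y).sub (L.hasDerivAt_zeta hy)
  have h1 := (hP.sub_const (L.weierstrassP y)).mul (hζ.sub_const (L.zeta y))
  have h2 := (hP'.sub_const (L.derivWeierstrassP y)).const_mul (1 / 2)
  have hc : ContinuousAt (fun x ↦ x + y) y := by fun_prop
  have h3 := h1.unique (h2.congr_of_eventuallyEq (by
    filter_upwards [L.compl_lattice_mem_nhds hy,
        hc.eventually_mem (L.compl_lattice_mem_nhds hy2)] with z hz hz'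
    exact L.weierstrassP_sub_mul_zeta_add_sub hz hy hz'))
  simp only [Pi.sub_apply, sub_self, zero_mul, add_zero] at h3
  rw [← sub_eq_iff_eq_add', eq_div_iff (by simpa)]
  linear_combination 2 * h3

lemma tendsto_sub_mul_riccati_defect {s κ : ℂ} {h k : ℂ → ℂ} (hh : AnalyticAt ℂ h s)
    (hk : AnalyticAt ℂ k s) :
    Tendsto (fun z ↦ (z - s) * (deriv (fun z ↦ h z - 1 / 2 * L.zeta (z - s)) z
      + (h z - 1 / 2 * L.zeta (z - s)) ^ 2
      - (3 / 4 * L.weierstrassP (z - s) + κ * L.zeta (z - s) + k z))) (𝓝[≠] s)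
      (𝓝 (-(h s + κ))) := by
  have hR : AnalyticAt ℂ (fun z ↦ L.zetaExcept (z - s)) s :=
    AnalyticAt.fun_comp (g := L.zetaExcept) (f := fun z ↦ z - s)
      (by simpa using L.analyticAt_zetaExcept) (by fun_prop)
  have hP : AnalyticAt ℂ (fun z ↦ L.weierstrassPExcept 0 (z - s)) s :=
    AnalyticAt.fun_comp (g := L.weierstrassPExcept 0) (f := fun z ↦ z - s)
      (by simpa using L.analyticAt_weierstrassPExcept 0) (by fun_prop)
  let F : ℂ → ℂ := fun z ↦
    1 / 4 * (2 * L.zetaExcept (z - s) + (z - s) * L.zetaExcept (z - s) ^ 2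
      - (z - s) * L.weierstrassPExcept 0 (z - s))
    - (1 + (z - s) * L.zetaExcept (z - s)) * (h z + κ)
    + (z - s) * (deriv h z + h z ^ 2 - k z)
  have hF : AnalyticAt ℂ F s := by fun_prop
  have hFs : F s = -(h s + κ) := by simp [F, L.zetaExcept_zero]
  rw [← hFs]
  refine (hF.continuousAt.tendsto.mono_left nhdsWithin_le_nhds).congr' ?_
  have hc : ContinuousAt (fun z ↦ z - s) s := by fun_prop
  have hev : ∀ᶠ z in 𝓝 s, z - s ∈ ((L.lattice : Set ℂ) \ {0})ᶜ :=
    hc.eventually_mem (by simpa using L.compl_lattice_sdiff_singleton_mem_nhds 0)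
  filter_upwards [nhdsWithin_le_nhds hev, nhdsWithin_le_nhds hh.eventually_analyticAt,
    self_mem_nhdsWithin] with z hz hhz hzs
  have hzs' : z - s ≠ 0 := sub_ne_zero.mpr hzs
  have hzL : z - s ∉ L.lattice := fun h ↦ hz ⟨h, hzs'⟩
  have hd := hhz.differentiableAt.hasDerivAt.sub
    (((L.hasDerivAt_zeta hzL).comp_sub_const z s).const_mul (1 / 2))
  have hd' : deriv (fun z ↦ h z - 1 / 2 * L.zeta (z - s)) z =
      deriv h z - 1 / 2 * -L.weierstrassP (z - s) := hd.deriv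
  rw [hd', L.weierstrassP_eq, zeta]
  simp only [F]
  field_simp
  ring

lemma deriv_derivWeierstrassP_neg (z : ℂ) :
    deriv L.derivWeierstrassP (-z) = deriv L.derivWeierstrassP z := by
  have h : (fun z ↦ L.derivWeierstrassP (-z)) = fun z ↦ -L.derivWeierstrassP z :=
    funext L.derivWeierstrassP_neg
  have := congrFun (congrArg deriv h) z
  rw [deriv_comp_neg, deriv.fun_neg] at this
  exact neg_inj.mp this

/-- The residue at `p` of the defect in the Riccati equation for a logarithmic derivative with
simple poles at `a₁`, `a₂`, `0` and `±p`. -/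
lemma tendsto_sub_mul_riccati_defect_of_zeta {p a₁ a₂ : ℂ} (A B : ℂ) (hp : 2 * p ∉ L.lattice)
    (h1 : a₁ ∉ L.lattice) (h1m : a₁ - p ∉ L.lattice) (h1p : a₁ + p ∉ L.lattice)
    (h2 : a₂ ∉ L.lattice) (h2m : a₂ - p ∉ L.lattice) (h2p : a₂ + p ∉ L.lattice)
    {φ q : ℂ → ℂ}
    (hφ : ∀ z, φ z = L.zeta a₁ + L.zeta a₂ + L.zeta (z - a₁) + L.zeta (z - a₂) - L.zeta z
      - 1 / 2 * (L.zeta (z + p) + L.zeta (z - p)))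
    (hq : ∀ z, q z = 2 * L.weierstrassP z
      + 3 / 4 * (L.weierstrassP (z + p) + L.weierstrassP (z - p))
      + A * (L.zeta (z + p) - L.zeta (z - p)) + B) :
    Tendsto (fun z ↦ (z - p) * (deriv φ z + φ z ^ 2 - q z)) (𝓝[≠] p)
      (𝓝 (A - (L.derivWeierstrassP p + L.derivWeierstrassP a₁) /
            (2 * (L.weierstrassP p - L.weierstrassP a₁))
          - (L.derivWeierstrassP p + L.derivWeierstrassP a₂) /
            (2 * (L.weierstrassP p - L.weierstrassP a₂))
          + deriv L.derivWeierstrassP p / (4 * L.derivWeierstrassP p))) := by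
  have hp0 : p ∉ L.lattice := fun h ↦ hp (two_mul p ▸ add_mem h h)
  have hpp : p + p ∉ L.lattice := two_mul p ▸ hp
  rw [← neg_mem_iff, neg_sub, sub_eq_add_neg] at h1m h2m
  rw [add_comm] at h1p h2p
  have d1 := L.zeta_add hp0 (y := -a₁) (by simpa) h1m (by simpa)
  have d2 := L.zeta_add hp0 (y := -a₂) (by simpa) h2m (by simpa)
  rw [zeta_neg, derivWeierstrassP_neg, weierstrassP_neg, sub_neg_eq_add] at d1 d2
  have ep := L.zeta_two_mul hp0 hp
  have hh : AnalyticAt ℂ (fun z ↦ L.zeta a₁ + L.zeta a₂ + L.zeta (z + -a₁) + L.zeta (z + -a₂)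
      - L.zeta z - 1 / 2 * L.zeta (z + p)) p :=
    ((((analyticAt_const.add (L.analyticAt_zeta_add h1m)).add (L.analyticAt_zeta_add h2m)).sub
      (L.analyticAt_zeta hp0)).sub (analyticAt_const.mul (L.analyticAt_zeta_add hpp)))
  have hP : AnalyticAt ℂ (fun z ↦ L.weierstrassP (z + p)) p :=
    AnalyticAt.fun_comp (g := L.weierstrassP) (f := fun z ↦ z + p)
      (L.analyticOnNhd_weierstrassP _ hpp) (by fun_prop)
  have hk : AnalyticAt ℂ (fun z ↦ 2 * L.weierstrassP z + 3 / 4 * L.weierstrassP (z + p)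
      + A * L.zeta (z + p) + B) p :=
    (((analyticAt_const.mul (L.analyticOnNhd_weierstrassP p hp0)).add (analyticAt_const.mul hP)).add
      (analyticAt_const.mul (L.analyticAt_zeta_add hpp))).add analyticAt_const
  have key := L.tendsto_sub_mul_riccati_defect (κ := -A) hh hk
  have e : φ = fun z ↦ L.zeta a₁ + L.zeta a₂ + L.zeta (z + -a₁) + L.zeta (z + -a₂) - L.zeta z
      - 1 / 2 * L.zeta (z + p) - 1 / 2 * L.zeta (z - p) := by
    ext z
    rw [hφ]
    ring_nf
  have hlim : -(L.zeta a₁ + L.zeta a₂ + L.zeta (p + -a₁) + L.zeta (p + -a₂)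
      - L.zeta p - 1 / 2 * L.zeta (p + p) + -A) =
      A - (L.derivWeierstrassP p + L.derivWeierstrassP a₁) /
            (2 * (L.weierstrassP p - L.weierstrassP a₁))
          - (L.derivWeierstrassP p + L.derivWeierstrassP a₂) /
            (2 * (L.weierstrassP p - L.weierstrassP a₂))
          + deriv L.derivWeierstrassP p / (4 * L.derivWeierstrassP p) := by
    rw [← two_mul p, ep, d1, d2]
    ring
  rw [hlim] at key
  refine key.congr fun z ↦ ?_
  rw [← e, hq, congrFun e z]
  ring

end PeriodPair

/-- The period pair `(1, τ)`. -/
def tauPair (τ : ℂ) (hτ : 0 < τ.im) : PeriodPair where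
  ω₁ := 1
  ω₂ := τ
  indep := by
    rw [LinearIndependent.pair_iff]
    intro a b h
    have him := congrArg Complex.im h
    have hre := congrArg Complex.re h
    simp at him hre
    obtain rfl := him.resolve_right hτ.ne'
    simpa using hre

lemma mem_tauPair_lattice {τ : ℂ} (hτ : 0 < τ.im) {z : ℂ} :
    z ∈ (tauPair τ hτ).lattice ↔ z ∈ Lam τ := by
  simp [PeriodPair.mem_lattice, Lam, tauPair, eq_comm]

lemma tsum_Lam'_eq {τ : ℂ} (hτ : 0 < τ.im) (f : ℂ → ℂ) :
    ∑' ω : Lam' τ, f ω = ∑' l : (tauPair τ hτ).lattice, if l.1 = 0 then 0 else f l := by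
  rw [tsum_subtype (Lam' τ) f]
  have := tsum_subtype ((tauPair τ hτ).lattice : Set ℂ) (fun l ↦ if l = 0 then 0 else f l)
  refine Eq.trans ?_ this.symm
  congr with z
  by_cases h0 : z = 0 <;> by_cases hz : z ∈ Lam τ <;>
    simp [Set.indicator, Lam', mem_tauPair_lattice, h0, hz]

lemma wp_eq {τ : ℂ} (hτ : 0 < τ.im) : wp τ = (tauPair τ hτ).weierstrassP := by
  ext z
  rw [PeriodPair.weierstrassP_eq, wp, tsum_Lam'_eq hτ fun ω ↦ 1 / (z - ω) ^ 2 - 1 / ω ^ 2]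
  rfl

lemma wzeta_eq {τ : ℂ} (hτ : 0 < τ.im) : wzeta τ = (tauPair τ hτ).zeta := by
  ext z
  rw [PeriodPair.zeta, wzeta, tsum_Lam'_eq hτ fun ω ↦ 1 / (z - ω) + 1 / ω + z / ω ^ 2]
  rfl

/-- if `c = ζ(a₁)+ζ(a₂)`, then `g` has at most simple poles at
`z = p` and `z = −p` with the stated residues. -/
theorem stmt_9 (τ p a₁ a₂ c A : ℂ) (hτ : 0 < τ.im) (hp : 2 * p ∉ Lam τ)
    (h12 : a₁ - a₂ ∉ Lam τ) (ha₁ : a₁ ∉ Sset τ p) (ha₂ : a₂ ∉ Sset τ p)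
    (hc : c = wzeta τ a₁ + wzeta τ a₂) :
    Tendsto (fun z => (z - p) * gfun τ p a₁ a₂ c A z) (𝓝[≠] p)
      (𝓝 (A - (wpd τ p + wpd τ a₁) / (2 * (wp τ p - wp τ a₁))
            - (wpd τ p + wpd τ a₂) / (2 * (wp τ p - wp τ a₂))
            + wpdd τ p / (4 * wpd τ p))) ∧
    Tendsto (fun z => (z - (-p)) * gfun τ p a₁ a₂ c A z) (𝓝[≠] (-p))
      (𝓝 (-(A - (wpd τ p - wpd τ a₁) / (2 * (wp τ p - wp τ a₁))
            - (wpd τ p - wpd τ a₂) / (2 * (wp τ p - wp τ a₂))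
            + wpdd τ p / (4 * wpd τ p)))) := by
  have hwpd : wpd τ = (tauPair τ hτ).derivWeierstrassP := by
    rw [wpd, wp_eq hτ, PeriodPair.deriv_weierstrassP]
  have hwpdd : wpdd τ = deriv (tauPair τ hτ).derivWeierstrassP := by
    rw [wpdd, wp_eq hτ, PeriodPair.deriv_weierstrassP]
  have hφ (z : ℂ) : phiac τ p a₁ a₂ c z = c + wzeta τ (z - a₁) + wzeta τ (z - a₂) - wzeta τ z
      - 1 / 2 * (wzeta τ (z + p) + wzeta τ (z - p)) := rfl
  have hq (z : ℂ) : qpot τ p A z = 2 * wp τ z + 3 / 4 * (wp τ (z + p) + wp τ (z - p))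
      + A * (wzeta τ (z + p) - wzeta τ (z - p)) + Bc τ p A := rfl
  simp only [Sset, Set.mem_union, Set.mem_ofPred_eq, not_or, ← mem_tauPair_lattice hτ] at hp ha₁ ha₂
  obtain ⟨⟨h1, h1m⟩, h1p⟩ := ha₁
  obtain ⟨⟨h2, h2m⟩, h2p⟩ := ha₂
  simp only [gfun, hwpd, hwpdd]
  rw [wp_eq hτ] at hq ⊢
  rw [wzeta_eq hτ] at hφ hq hc
  rw [hc] at hφ ⊢
  generalize phiac τ p a₁ a₂ _ = φ at *
  generalize qpot τ p A = q at *
  generalize Bc τ p A = B at *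
  generalize tauPair τ hτ = L at *
  refine ⟨L.tendsto_sub_mul_riccati_defect_of_zeta A B hp h1 h1m h1p h2 h2m h2p hφ hq, ?_⟩
  convert! L.tendsto_sub_mul_riccati_defect_of_zeta (-A) B (p := -p) (by simpa) h1 (by simpa)
    (by simpa [← sub_eq_add_neg]) h2 (by simpa) (by simpa [← sub_eq_add_neg]) (φ := φ) (q := q)
    (fun z ↦ ?_) (fun z ↦ ?_) using 2
  · rw [L.derivWeierstrassP_neg, L.weierstrassP_neg, L.deriv_derivWeierstrassP_neg]
    ring
  · rw [hφ, sub_neg_eq_add, ← sub_eq_add_neg]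
    ring
  · rw [hq, sub_neg_eq_add, ← sub_eq_add_neg]
    ring
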